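/- Let γ > 1, 0 ≤ b̃ < 1 and 1 < β < (γ+1)/(γ−1+2b̃), and let F̃(X) = h₀ + h₁X + h₂X² + h₃X³ with h₀ = −(1 − b̃β)²(β − 1)²/β, h₁ = (1 − b̃β)²(β − 1)(3 − 1/β) − 2(β − 1)(1 − b̃β)((γ+1−2b̃)β − (γ−1)), h₂ = −((3β − 2)(1 − b̃β)² + (β − 1)((γ+1−2b̃)β − (γ−1))(γ−1+2b̃β)), h₃ = β(1 − b̃β)². Then F̃ has exactly one positive zero x*, one has F̃(1) < 0 so that x* > 1, and for all X > 0: F̃(X) ≥ 0 if and only if X ≥ x*. -/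

import Mathlib

/-- For a cubic whose only positive coefficient is the leading one, nonnegativity at a positive
point propagates to strict positivity at all larger points. -/
theorem cubic_pos_of_nonneg_of_lt {a b c d x y : ℝ} (ha : a < 0) (hb : b < 0) (hc : c < 0)
    (hx : 0 < x) (hxy : x < y) (h : 0 ≤ a + b * x + c * x ^ 2 + d * x ^ 3) :
    0 < a + b * y + c * y ^ 2 + d * y ^ 3 := by
  have hy : 0 < y := hx.trans hxy
  have hs : 0 < y - x := sub_pos.2 hxy
  have hab : 0 < (-a) * ((y - x) * (y ^ 2 + x * y + x ^ 2)) :=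
    mul_pos (neg_pos.2 ha) (by positivity)
  have hbb : 0 < (-b) * (x * y * ((y - x) * (y + x))) := mul_pos (neg_pos.2 hb) (by positivity)
  have hcb : 0 < (-c) * (x ^ 2 * y ^ 2 * (y - x)) := mul_pos (neg_pos.2 hc) (by positivity)
  have hnn : 0 ≤ (a + b * x + c * x ^ 2 + d * x ^ 3) * y ^ 3 := mul_nonneg h (by positivity)
  have key : 0 < (a + b * y + c * y ^ 2 + d * y ^ 3) * x ^ 3 := by
    nlinarith only [hab, hbb, hcb, hnn]
  exact pos_of_mul_pos_left key (by positivity)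

/-- A cubic with positive leading coefficient, negative remaining coefficients and a negative
value at `1` has a zero larger than `1`. -/
theorem exists_one_lt_cubic_eq_zero {a b c d : ℝ} (ha : a < 0) (hb : b < 0) (hc : c < 0)
    (hd : 0 < d) (h1 : a + b + c + d < 0) :
    ∃ x : ℝ, 1 < x ∧ a + b * x + c * x ^ 2 + d * x ^ 3 = 0 := by
  obtain ⟨M, hM⟩ : ∃ M : ℝ, M = 1 + (-(a + b + c)) / d := ⟨_, rfl⟩
  have hdM : d * M = d - (a + b + c) := by rw [hM]; field_simp; ring
  have hM1 : 1 ≤ M := by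
    rw [hM]
    have : 0 < (-(a + b + c)) / d := div_pos (by linarith) hd
    linarith
  have hMpos : 0 ≤ a + b * M + c * M ^ 2 + d * M ^ 3 := by
    have e : d * M ^ 3 = (d - (a + b + c)) * M ^ 2 := by rw [← hdM]; ring
    have ea : 0 ≤ (-a) * (M ^ 2 - 1) := mul_nonneg (by linarith) (by nlinarith)
    have eb : 0 ≤ (-b) * (M * (M - 1)) :=
      mul_nonneg (by linarith) (mul_nonneg (by linarith) (by linarith))
    have ed : 0 ≤ d * M ^ 2 := by positivity
    rw [e]
    nlinarith only [ea, eb, ed]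
  have hcont : ContinuousOn (fun x : ℝ => a + b * x + c * x ^ 2 + d * x ^ 3) (Set.Icc 1 M) := by
    fun_prop
  obtain ⟨x, hx, hx0⟩ := intermediate_value_Icc hM1 hcont
    (show (0 : ℝ) ∈ Set.Icc _ _ from ⟨by simpa using h1.le, hMpos⟩)
  refine ⟨x, lt_of_le_of_ne hx.1 ?_, hx0⟩
  rintro rfl
  simp at hx0
  linarith

/-- The cubic `F̃(X) = h₀ + h₁X + h₂X² + h₃X³` has exactly one positive zero `x*`,
satisfies `F̃(1) < 0` (so `x* > 1`), and for `X > 0`, `F̃(X) ≥ 0 ↔ X ≥ x*`. -/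
theorem cubic_unique_positive_zero
    (γ bt β : ℝ) (F : ℝ → ℝ)
    (hγ : 1 < γ) (hbt0 : 0 ≤ bt) (hbt1 : bt < 1)
    (hβ : 1 < β) (hβup : β < (γ + 1) / (γ - 1 + 2 * bt))
    (hF : ∀ X : ℝ, F X
      = (-(1 - bt * β) ^ 2 * (β - 1) ^ 2 / β)
      + ((1 - bt * β) ^ 2 * (β - 1) * (3 - 1 / β)
          - 2 * (β - 1) * (1 - bt * β) * ((γ + 1 - 2 * bt) * β - (γ - 1))) * X
      + (-((3 * β - 2) * (1 - bt * β) ^ 2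
          + (β - 1) * ((γ + 1 - 2 * bt) * β - (γ - 1)) * (γ - 1 + 2 * bt * β))) * X ^ 2
      + (β * (1 - bt * β) ^ 2) * X ^ 3) :
    ∃ xstar : ℝ, 0 < xstar ∧ F xstar = 0 ∧
      (∀ y : ℝ, 0 < y → F y = 0 → y = xstar) ∧
      F 1 < 0 ∧ 1 < xstar ∧
      (∀ X : ℝ, 0 < X → (0 ≤ F X ↔ xstar ≤ X)) := by
  have hβ0 : 0 < β := by linarith
  have hg : 0 < γ - 1 + 2 * bt := by linarith
  have hup : β * (γ - 1 + 2 * bt) < γ + 1 := (lt_div_iff₀ hg).1 hβup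
  have hc : 0 < 1 - bt * β := by
    have hγb : 0 < (γ - 1) * (1 - bt) := mul_pos (by linarith) (by linarith)
    have hbβ : 0 ≤ bt * (γ + 1 - β * (γ - 1 + 2 * bt)) := mul_nonneg hbt0 (by linarith)
    refine pos_of_mul_pos_right (b := 1 - bt * β) (a := γ - 1 + 2 * bt) ?_ hg.le
    linarith
  have hs : 0 < β - 1 := sub_pos.2 hβ
  have hDlow : 2 * (1 - bt) ≤ (γ + 1 - 2 * bt) * β - (γ - 1) := by
    nlinarith [mul_pos (sub_pos.2 hγ) hs, mul_pos (sub_pos.2 hbt1) hs]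
  have hcle : 1 - bt * β ≤ 1 - bt := by nlinarith
  obtain ⟨D, hD⟩ : ∃ D, D = (γ + 1 - 2 * bt) * β - (γ - 1) := ⟨_, rfl⟩
  obtain ⟨E, hE⟩ : ∃ E, E = γ - 1 + 2 * bt * β := ⟨_, rfl⟩
  have hE0 : 0 < E := by rw [hE]; nlinarith
  obtain ⟨c, hcdef⟩ : ∃ c, c = 1 - bt * β := ⟨_, rfl⟩
  rw [← hD] at hDlow
  rw [← hcdef] at hc hcle
  simp only [← hD, ← hE, ← hcdef] at hF
  have hD0 : 0 < D := by linarith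
  have hinv : 0 < 1 / β := by positivity
  have h0 : -c ^ 2 * (β - 1) ^ 2 / β < 0 := by
    have : 0 < c ^ 2 * (β - 1) ^ 2 / β := by positivity
    rw [neg_mul, neg_div]
    linarith
  have h1 : c ^ 2 * (β - 1) * (3 - 1 / β) - 2 * (β - 1) * c * D < 0 := by
    have hlt : c * (3 - 1 / β) < 2 * D := by nlinarith [mul_pos hc hinv]
    nlinarith [mul_pos (mul_pos hs hc) (sub_pos.2 hlt)]
  have h2 : -((3 * β - 2) * c ^ 2 + (β - 1) * D * E) < 0 := by
    have hβ2 : 0 < 3 * β - 2 := by linarith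
    exact neg_lt_zero.2 (by positivity)
  have h3 : 0 < β * c ^ 2 := by positivity
  have hsum : -c ^ 2 * (β - 1) ^ 2 / β + (c ^ 2 * (β - 1) * (3 - 1 / β) - 2 * (β - 1) * c * D)
      + -((3 * β - 2) * c ^ 2 + (β - 1) * D * E) + β * c ^ 2 < 0 := by
    have e : -c ^ 2 * (β - 1) ^ 2 / β + (c ^ 2 * (β - 1) * (3 - 1 / β) - 2 * (β - 1) * c * D)
      + -((3 * β - 2) * c ^ 2 + (β - 1) * D * E) + β * c ^ 2
        = -((β - 1) * D * (2 * c + E)) := by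
      field_simp
      ring
    rw [e]
    exact neg_lt_zero.2 (by positivity)
  obtain ⟨x, hx1, hx0⟩ := exists_one_lt_cubic_eq_zero h0 h1 h2 h3 hsum
  rw [← hF] at hx0
  have hxpos : 0 < x := by linarith
  have hmono : ∀ {u v : ℝ}, 0 < u → u < v → 0 ≤ F u → 0 < F v := by
    intro u v hu huv h
    rw [hF] at h ⊢
    exact cubic_pos_of_nonneg_of_lt h0 h1 h2 hu huv h
  refine ⟨x, hxpos, hx0, fun y hy hy0 => ?_, ?_, hx1, fun X hX => ⟨fun h => ?_, fun h => ?_⟩⟩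
  · rcases lt_trichotomy y x with h | h | h
    · exact absurd hx0 (hmono hy h hy0.ge).ne'
    · exact h
    · exact absurd hy0 (hmono hxpos h hx0.ge).ne'
  · rw [hF]
    simpa only [mul_one, one_pow] using hsum
  · by_contra! hlt
    exact absurd hx0 (hmono hX hlt h).ne'
  · rcases h.eq_or_lt with rfl | h
    · exact hx0.ge
    · exact (hmono hxpos h hx0.ge).le
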